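/- Let f(β) = (1/2)‖y − Xβ‖² + Ω_w(β) where Ω_w is the OWL norm with minimum consecutive weight gap Δ_w = min_l (w_l − w_{l+1}) > 0. Suppose β̂ minimizes f. If columns x_i, x_j of X satisfy ‖x_i − x_j‖ < Δ_w/‖y‖, then |β̂_i| = |β̂_j|. -/

import Mathlib

noncomputable def owlSorted {N : ℕ} (β : Fin N → ℝ) : Fin N → ℝ :=
  fun i => |β (Tuple.sort (fun j => |β j|) i.rev)|

noncomputable def owl {N : ℕ} (w β : Fin N → ℝ) : ℝ :=
  ∑ i, w i * owlSorted β i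

noncomputable def owlDual {M : ℕ} (v z : Fin M → ℝ) : ℝ :=
  ⨆ i : Fin M, (∑ j ∈ Finset.univ.filter (fun j => j ≤ i), v j)⁻¹ *
    ∑ j ∈ Finset.univ.filter (fun j => j ≤ i), owlSorted z j

/-- The permutation listing the coordinates of `β` by decreasing absolute value. -/
noncomputable def owlPerm {N : ℕ} (β : Fin N → ℝ) : Equiv.Perm (Fin N) :=
  Fin.revPerm.trans (Tuple.sort fun j => |β j|)

theorem owlSorted_eq {N : ℕ} (β : Fin N → ℝ) (k : Fin N) :
    owlSorted β k = |β (owlPerm β k)| := rfl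

theorem owlSorted_antitone {N : ℕ} (β : Fin N → ℝ) : Antitone (owlSorted β) :=
  fun _ _ h => Tuple.monotone_sort (fun j => |β j|) (Fin.rev_le_rev.mpr h)

theorem owl_nonneg {N : ℕ} {w : Fin N → ℝ} (hw : ∀ k, 0 ≤ w k) (β : Fin N → ℝ) :
    0 ≤ owl w β :=
  Finset.sum_nonneg fun k _ => mul_nonneg (hw k) (abs_nonneg _)

theorem owl_zero {N : ℕ} (w : Fin N → ℝ) : owl w 0 = 0 := by
  simp [owl, owlSorted]

/-- Rearrangement inequality for the OWL norm. -/
theorem sum_mul_abs_comp_perm_le_owl {N : ℕ} {w : Fin N → ℝ} (hw : Antitone w)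
    (β : Fin N → ℝ) (e : Equiv.Perm (Fin N)) : ∑ k, w k * |β (e k)| ≤ owl w β := by
  have h := (hw.monovary (owlSorted_antitone β)).sum_mul_comp_perm_le_sum_mul
    (σ := e.trans (owlPerm β).symm)
  simpa [owlSorted_eq, owl] using h

/-- Moving an amount `ε` of absolute value from a coordinate to one that remains smaller
decreases the OWL norm by at least `ε` times the minimal weight gap. -/
theorem owl_add_le_of_transfer {N : ℕ} {w : Fin N → ℝ} (hw : Antitone w) (hnn : ∀ k, 0 ≤ w k)
    {δ ε : ℝ} (hgap : ∀ a b, a < b → δ ≤ w a - w b) (hε : 0 ≤ ε) {β γ : Fin N → ℝ} {i j : Fin N}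
    (hi : |γ i| + ε ≤ |β i|) (hj : |γ j| ≤ |β j| + ε) (hlt : |γ j| < |γ i|)
    (hne : ∀ k, k ≠ i → k ≠ j → γ k = β k) : owl w γ + ε * δ ≤ owl w β := by
  set σ := (owlPerm γ).symm with hσ
  have hsum (η : Fin N → ℝ) : ∑ k, w k * |η (owlPerm γ k)| = ∑ k, w (σ k) * |η k| := by
    rw [← Equiv.sum_comp (owlPerm γ) fun k => w (σ k) * |η k|]
    simp [hσ]
  have hβ := sum_mul_abs_comp_perm_le_owl hw β (owlPerm γ)
  have hγ : owl w γ = ∑ k, w (σ k) * |γ k| := hsum γ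
  rw [hsum] at hβ
  have hord : σ i < σ j := by
    by_contra! h
    have := owlSorted_antitone γ h
    simp only [owlSorted_eq, hσ, Equiv.apply_symm_apply] at this
    linarith
  have hij : i ≠ j := by
    rintro rfl
    exact lt_irrefl _ hlt
  have hdiff : ∑ k, w (σ k) * |β k| - ∑ k, w (σ k) * |γ k| =
      w (σ i) * (|β i| - |γ i|) + w (σ j) * (|β j| - |γ j|) := by
    rw [← Finset.sum_sub_distrib, Fintype.sum_eq_add i j hij]
    · ring
    · rintro k ⟨hki, hkj⟩
      rw [hne k hki hkj, sub_self]
  have h₁ := mul_le_mul_of_nonneg_left (show ε ≤ |β i| - |γ i| by linarith) (hnn (σ i))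
  have h₂ := mul_le_mul_of_nonneg_left (show -ε ≤ |β j| - |γ j| by linarith) (hnn (σ j))
  have h₃ := mul_le_mul_of_nonneg_left (hgap _ _ hord) hε
  linarith

theorem abs_le_abs_of_owl_minimizer {E : Type*} [NormedAddCommGroup E] [InnerProductSpace ℝ E]
    {N : ℕ} {x : Fin N → E} {y : E} {w : Fin N → ℝ} (hw : Antitone w) (hnn : ∀ k, 0 ≤ w k)
    {δ : ℝ} (hgap : ∀ a b, a < b → δ ≤ w a - w b) {β : Fin N → ℝ}
    (hmin : ∀ γ : Fin N → ℝ,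
      (1 / 2) * ‖y - ∑ k, β k • x k‖ ^ 2 + owl w β ≤
      (1 / 2) * ‖y - ∑ k, γ k • x k‖ ^ 2 + owl w γ)
    {i j : Fin N} (hx : ‖x i - x j‖ * ‖y‖ < δ) : |β i| ≤ |β j| := by
  by_contra! hlt
  have hij : i ≠ j := by
    rintro rfl
    exact lt_irrefl _ hlt
  set r := y - ∑ k, β k • x k with hr
  set d := x i - x j with hd
  have hry : ‖r‖ ≤ ‖y‖ := by
    have h0 := hmin 0
    simp only [Pi.zero_apply, zero_smul, Finset.sum_const_zero, sub_zero, owl_zero] at h0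
    have := owl_nonneg hnn β
    exact pow_le_pow_iff_left₀ (norm_nonneg r) (norm_nonneg y) two_ne_zero |>.mp (by linarith)
  obtain ⟨s, hs, hsβ⟩ : ∃ s : ℝ, |s| = 1 ∧ β i = s * |β i| := by
    rcases le_total 0 (β i) with h | h
    · exact ⟨1, by simp, by simp [abs_of_nonneg h]⟩
    · exact ⟨-1, by simp, by simp [abs_of_nonpos h]⟩
  have key (ε : ℝ) (hε : 0 < ε) (hsmall : 2 * ε < |β i| - |β j|) :
      δ ≤ ‖d‖ * ‖y‖ + ε / 2 * ‖d‖ ^ 2 := by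
    set γ : Fin N → ℝ := β + (s * ε) • (Pi.single j 1 - Pi.single i 1) with hγ
    have hγi : |γ i| = |β i| - ε := by
      have : γ i = s * (|β i| - ε) := by
        simp only [hγ, Pi.add_apply, Pi.smul_apply, Pi.sub_apply, Pi.single_eq_same,
          Pi.single_eq_of_ne hij, smul_eq_mul]
        linear_combination hsβ
      rw [this, abs_mul, hs, one_mul, abs_of_nonneg]
      linarith [abs_nonneg (β j)]
    have hγj : |γ j| ≤ |β j| + ε := by
      have : γ j = β j + s * ε := by simp [hγ, hij.symm]
      rw [this]
      refine (abs_add_le _ _).trans ?_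
      rw [abs_mul, hs, one_mul, abs_of_pos hε]
    have howl := owl_add_le_of_transfer hw hnn hgap hε.le (β := β) (γ := γ) (i := i) (j := j)
      (by linarith) hγj (by linarith) fun k hki hkj => by simp [hγ, hki, hkj]
    have hres : y - ∑ k, γ k • x k = r + (s * ε) • d := by
      have : ∑ k, γ k • x k = ∑ k, β k • x k + (s * ε) • (x j - x i) := by
        simp [hγ, add_smul, sub_smul, mul_smul, Finset.sum_add_distrib,
          Pi.single_apply, smul_sub]
      rw [this, hr, hd]
      module
    have hnorm : ‖r + (s * ε) • d‖ ≤ ‖r‖ + ε * ‖d‖ := by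
      refine (norm_add_le _ _).trans ?_
      rw [norm_smul, Real.norm_eq_abs, abs_mul, hs, one_mul, abs_of_pos hε]
    have hsq := pow_le_pow_left₀ (norm_nonneg _) hnorm 2
    have hm := hmin γ
    rw [hres] at hm
    have hrd := mul_le_mul_of_nonneg_left hry (mul_nonneg hε.le (norm_nonneg d))
    refine le_of_mul_le_mul_left ?_ hε
    linarith
  have hg : 0 < δ - ‖d‖ * ‖y‖ := sub_pos.mpr hx
  have hb : 0 < |β i| - |β j| := sub_pos.mpr hlt
  obtain ⟨ε, hε, hε₁, hε₂⟩ : ∃ ε : ℝ, 0 < ε ∧ 2 * ε < |β i| - |β j| ∧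
      ε * ‖d‖ ^ 2 ≤ δ - ‖d‖ * ‖y‖ := by
    refine ⟨min ((|β i| - |β j|) / 4) ((δ - ‖d‖ * ‖y‖) / (‖d‖ ^ 2 + 1)), by positivity, ?_, ?_⟩
    · linarith [min_le_left ((|β i| - |β j|) / 4) ((δ - ‖d‖ * ‖y‖) / (‖d‖ ^ 2 + 1))]
    · refine (mul_le_mul_of_nonneg_right (min_le_right _ _) (by positivity)).trans ?_
      rw [div_mul_eq_mul_div, div_le_iff₀ (by positivity)]
      nlinarith
  linarith [key ε hε hε₁]

theorem stmt_11 {n N : ℕ} (x : Fin (N + 2) → EuclideanSpace ℝ (Fin n))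
    (y : EuclideanSpace ℝ (Fin n)) (hy : y ≠ 0)
    (w : Fin (N + 2) → ℝ) (hanti : StrictAnti w) (hnn : ∀ i, 0 ≤ w i)
    (Δw : ℝ)
    (hΔw : Δw = Finset.univ.inf' Finset.univ_nonempty
      (fun l : Fin (N + 1) => w l.castSucc - w l.succ))
    (βh : Fin (N + 2) → ℝ)
    (hmin : ∀ β : Fin (N + 2) → ℝ,
      (1 / 2) * ‖y - ∑ j, βh j • x j‖ ^ 2 + owl w βh ≤
      (1 / 2) * ‖y - ∑ j, β j • x j‖ ^ 2 + owl w β)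
    (i j : Fin (N + 2)) (hij : ‖x i - x j‖ < Δw / ‖y‖) :
    |βh i| = |βh j| := by
  have hgap (a b : Fin (N + 2)) (hab : a < b) : Δw ≤ w a - w b := by
    obtain ⟨l, rfl⟩ := Fin.exists_castSucc_eq.mpr (hab.trans_le (Fin.le_last b)).ne
    have h₁ : Δw ≤ w l.castSucc - w l.succ := hΔw ▸ Finset.inf'_le _ (Finset.mem_univ l)
    have h₂ : w b ≤ w l.succ := hanti.antitone (Fin.castSucc_lt_iff_succ_le.mp hab)
    linarith
  have hx := (lt_div_iff₀ (norm_pos_iff.mpr hy)).mp hij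
  exact le_antisymm (abs_le_abs_of_owl_minimizer hanti.antitone hnn hgap hmin hx)
    (abs_le_abs_of_owl_minimizer hanti.antitone hnn hgap hmin (by rwa [norm_sub_rev (x j)]))
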